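/- arXiv:1805.08764 — 3 statements merged into one kernel-verified Lean document; each statement's English description precedes it below -/
import Mathlib

section
/- The three surface gravities are all strictly positive: κ_c > 0, κ₊ > 0 and κ₋ > 0. -/
noncomputable section

/-- The metric coefficient `μ(r) = 1 - 2M/r + e²/r² - (Λ/3)r²`. -/
def mu (M e Λ : ℝ) (r : ℝ) : ℝ := 1 - 2*M/r + e^2/r^2 - (Λ/3)*r^2

/-- Surface gravity of the event horizon: `κ₊ = (1/2)·μ′(r₊)`. -/
def kappaP (M e Λ rp : ℝ) : ℝ := (1/2) * deriv (mu M e Λ) rp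

/-- Surface gravity of the Cauchy horizon: `κ₋ = -(1/2)·μ′(r₋)`. -/
def kappaM (M e Λ rm : ℝ) : ℝ := -(1/2) * deriv (mu M e Λ) rm

/-- Surface gravity of the cosmological horizon: `κ_c = -(1/2)·μ′(r_c)`. -/
def kappaC (M e Λ rc : ℝ) : ℝ := -(1/2) * deriv (mu M e Λ) rc

/-- Away from the origin, zeros of `mu` are roots of a quartic. -/
theorem mu_eq_zero_iff {M e Λ r : ℝ} (hr : r ≠ 0) :
    mu M e Λ r = 0 ↔ r^2 - 2*M*r + e^2 - Λ/3*r^4 = 0 := by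
  have h : mu M e Λ r = (r^2 - 2*M*r + e^2 - Λ/3*r^4) / r^2 := by
    unfold mu
    field_simp
  rw [h, div_eq_zero_iff, or_iff_left (pow_ne_zero 2 hr)]

theorem hasDerivAt_mu (M e Λ : ℝ) {r : ℝ} (hr : r ≠ 0) :
    HasDerivAt (mu M e Λ) (2*M/r^2 - 2*e^2/r^3 - 2*(Λ/3)*r) r := by
  have h := ((((hasDerivAt_const r (1 : ℝ)).sub
    ((hasDerivAt_const r (2*M)).div (hasDerivAt_id r) hr)).add
    ((hasDerivAt_const r (e^2)).div (hasDerivAt_pow 2 r) (pow_ne_zero 2 hr))).sub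
    ((hasDerivAt_pow 2 r).const_mul (Λ/3)))
  refine h.congr_deriv ?_
  simp only [id_eq]
  field_simp
  ring

/-- The derivative of `mu` at one of three distinct nonzero zeros, in factored form: the sum of the
roots of the associated quartic vanishes, so its fourth root is `-(x + y + z)`. -/
theorem deriv_mu_of_zeros {M e Λ x y z : ℝ} (hx : x ≠ 0) (hy : y ≠ 0) (hz : z ≠ 0)
    (hxy : x ≠ y) (hxz : x ≠ z) (hyz : y ≠ z)
    (hzx : mu M e Λ x = 0) (hzy : mu M e Λ y = 0) (hzz : mu M e Λ z = 0) :
    deriv (mu M e Λ) x = -(Λ/3) * ((x - y) * (x - z)) * (2*x + y + z) / x^2 := by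
  rw [mu_eq_zero_iff hx] at hzx
  rw [mu_eq_zero_iff hy] at hzy
  rw [mu_eq_zero_iff hz] at hzz
  have hdy : x + y - 2*M - Λ/3*((x + y)*(x^2 + y^2)) = 0 :=
    mul_left_cancel₀ (sub_ne_zero.2 hxy) (by linear_combination hzx - hzy)
  have hdz : x + z - 2*M - Λ/3*((x + z)*(x^2 + z^2)) = 0 :=
    mul_left_cancel₀ (sub_ne_zero.2 hxz) (by linear_combination hzx - hzz)
  have hd : 1 - Λ/3*(x^2 + y^2 + z^2 + x*y + y*z + z*x) = 0 :=
    mul_left_cancel₀ (sub_ne_zero.2 hyz) (by linear_combination hdy - hdz)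
  rw [(hasDerivAt_mu M e Λ hx).deriv]
  field_simp
  linear_combination (-6) * hzx + 3 * x * hdy + 3 * x * (x - y) * hd

/-- The three surface gravities are all strictly positive:
`κ_c > 0`, `κ₊ > 0` and `κ₋ > 0`. -/
theorem surface_gravities_pos (M e Λ rm rp rc : ℝ)
    (hM : 0 < M) (he : 0 < e) (hΛ : 0 < Λ)
    (h₀ : 0 < rm) (h₁ : rm < rp) (h₂ : rp < rc)
    (hzm : mu M e Λ rm = 0) (hzp : mu M e Λ rp = 0) (hzc : mu M e Λ rc = 0) :
    kappaC M e Λ rc > 0 ∧ kappaP M e Λ rp > 0 ∧ kappaM M e Λ rm > 0 := by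
  have hp : 0 < rp := h₀.trans h₁
  have hc : 0 < rc := hp.trans h₂
  have h₃ : rm < rc := h₁.trans h₂
  have hmp : 0 < rp - rm := sub_pos.2 h₁
  have hpc : 0 < rc - rp := sub_pos.2 h₂
  have hmc : 0 < rc - rm := sub_pos.2 h₃
  refine ⟨?_, ?_, ?_⟩
  · have h : 0 < Λ/3 * ((rc - rm) * (rc - rp)) * (2*rc + rm + rp) / rc^2 := by positivity
    rw [kappaC, deriv_mu_of_zeros hc.ne' h₀.ne' hp.ne' h₃.ne' h₂.ne' h₁.ne hzc hzm hzp]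
    linear_combination (1/2) * h
  · have h : 0 < Λ/3 * ((rp - rm) * (rc - rp)) * (2*rp + rm + rc) / rp^2 := by positivity
    rw [kappaP, deriv_mu_of_zeros hp.ne' h₀.ne' hc.ne' h₁.ne' h₂.ne h₃.ne hzp hzm hzc]
    linear_combination (1/2) * h
  · have h : 0 < Λ/3 * ((rp - rm) * (rc - rm)) * (2*rm + rp + rc) / rm^2 := by positivity
    rw [kappaM, deriv_mu_of_zeros h₀.ne' hp.ne' hc.ne' h₁.ne h₃.ne h₂.ne hzm hzp hzc]
    linear_combination (1/2) * h
end
end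

section
/- There exist δ > 0 and functions Ĥ_in, Ĥ_out : 𝒰 × (r₊, r_c + δ) → ℂ such that: (i) for every ω ∈ 𝒰, the maps r ↦ Ĥ_in(ω,r) and r ↦ Ĥ_out(ω,r) are real-analytic on (r₊, r_c + δ) and satisfy Ĥ_in(ω, r_c) = Ĥ_out(ω, r_c) = 1; (ii) for every fixed r, the maps ω ↦ Ĥ_in(ω,r) and ω ↦ Ĥ_out(ω,r) are holomorphic on 𝒰; (iii) for every ω ∈ 𝒰, the functions R_in(ω,r) := (r_c − r)^(−iω/(2κ_c))·Ĥ_in(ω,r) and R_out(ω,r) := (r_c − r)^(iω/(2κ_c))·Ĥ_out(ω,r) solve the radial o.d.e. with frequency ω on the interval (r₊, r_c). -/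
noncomputable section

/-- A twice-differentiable `R : I → ℂ` solves the radial o.d.e. with frequency `ω`:
`r⁻²·μ(r)·(d/dr)(r²·μ(r)·R′(r)) + ω²·R(r) = 0` for all `r ∈ I`. -/
def SolvesODE (M e Λ : ℝ) (ω : ℂ) (I : Set ℝ) (R : ℝ → ℂ) : Prop :=
  (∀ r ∈ I, DifferentiableAt ℝ R r) ∧
  (∀ r ∈ I, DifferentiableAt ℝ (deriv R) r) ∧
  ∀ r ∈ I, ((r:ℂ)^2)⁻¹ * (mu M e Λ r : ℂ) *
      deriv (fun s : ℝ => (s:ℂ)^2 * (mu M e Λ s : ℂ) * deriv R s) r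
    + ω^2 * R r = 0

/-- The set `𝒰` of `ω ∈ ℂ` not of the form `i·κ·n` with `κ ∈ {κ₊, κ₋, κ_c}` and
`n` a nonzero integer. -/
def calU (kp km kc : ℝ) : Set ℂ :=
  {ω : ℂ | ∀ κ ∈ ({kp, km, kc} : Set ℝ), ∀ n : ℤ, n ≠ 0 → ω ≠ Complex.I * κ * n}

/-- Coefficients of the Frobenius series of the equation
`(θ + z)² h + P (θ + z) h - z² S h = 0`, `θ = t d/dt`, where `p` and `s` are the Taylor
coefficients of `P` and `S`. -/
def frobeniusCoeff (p s : ℕ → ℂ) (z : ℂ) : ℕ → ℂ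
  | 0 => 1
  | n + 1 => -(∑ j : Fin (n + 1),
      ((j + z) * p (n + 1 - j) - z ^ 2 * s (n + 1 - j)) * frobeniusCoeff p s z j) /
        ((n + 1) * (n + 1 + 2 * z))

lemma frobeniusCoeff_succ (p s : ℕ → ℂ) (z : ℂ) (n : ℕ) :
    frobeniusCoeff p s z (n + 1) = -(∑ j ∈ Finset.range (n + 1),
      ((j + z) * p (n + 1 - j) - z ^ 2 * s (n + 1 - j)) * frobeniusCoeff p s z j) /
        ((n + 1) * (n + 1 + 2 * z)) := by
  rw [frobeniusCoeff, Finset.sum_range]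

/-- The exponents `z` for which `2 z` is not a negative integer. -/
def nonresonant : Set ℂ := {z : ℂ | ∀ n : ℕ, (n : ℂ) + 1 + 2 * z ≠ 0}

lemma frobeniusCoeff_recurrence {p s : ℕ → ℂ} (hp : p 0 = 0) (hs : s 0 = 1) {z : ℂ}
    (hz : z ∈ nonresonant) (n : ℕ) :
    n ^ 2 * frobeniusCoeff p s z n + 2 * z * (n * frobeniusCoeff p s z n)
      + z ^ 2 * frobeniusCoeff p s z n
      + ∑ kl ∈ Finset.HasAntidiagonal.antidiagonal n,
          ((kl.1 + z) * frobeniusCoeff p s z kl.1) * p kl.2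
      - z ^ 2 * ∑ kl ∈ Finset.HasAntidiagonal.antidiagonal n,
          frobeniusCoeff p s z kl.1 * s kl.2 = 0 := by
  rw [Finset.Nat.sum_antidiagonal_eq_sum_range_succ_mk,
    Finset.Nat.sum_antidiagonal_eq_sum_range_succ_mk, Finset.sum_range_succ, Finset.sum_range_succ]
  cases n with
  | zero => simp [hp, hs]
  | succ n =>
    have h1 : (n : ℂ) + 1 ≠ 0 := by exact_mod_cast n.succ_ne_zero
    have h2 := frobeniusCoeff_succ p s z n
    rw [eq_div_iff (mul_ne_zero h1 (hz n))] at h2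
    have h3 : ∑ j ∈ Finset.range (n + 1),
        ((j + z) * p (n + 1 - j) - z ^ 2 * s (n + 1 - j)) * frobeniusCoeff p s z j
        = ∑ j ∈ Finset.range (n + 1), ((j + z) * frobeniusCoeff p s z j) * p (n + 1 - j)
          - z ^ 2 * ∑ j ∈ Finset.range (n + 1), frobeniusCoeff p s z j * s (n + 1 - j) := by
      rw [Finset.mul_sum, ← Finset.sum_sub_distrib]
      exact Finset.sum_congr rfl fun j _ => by ring
    rw [h3] at h2
    simp only [Nat.sub_self, hp, hs]
    push_cast
    linear_combination h2

lemma differentiableOn_frobeniusCoeff (p s : ℕ → ℂ) (n : ℕ) :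
    DifferentiableOn ℂ (fun z => frobeniusCoeff p s z n) nonresonant := by
  induction n using Nat.strong_induction_on with
  | _ n ih =>
    cases n with
    | zero => simp only [frobeniusCoeff]; fun_prop
    | succ n =>
      simp only [frobeniusCoeff_succ]
      refine DifferentiableOn.div ?_ (by fun_prop) fun z hz =>
        mul_ne_zero (by exact_mod_cast n.succ_ne_zero) (hz n)
      refine DifferentiableOn.neg (DifferentiableOn.fun_sum fun j hj => ?_)
      exact DifferentiableOn.mul (by fun_prop) (ih j (Finset.mem_range.1 hj))

/-- Near a nonresonant parameter, the small denominators grow linearly. -/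
lemma exists_ball_linear_bound {z₀ : ℂ} (hz₀ : z₀ ∈ nonresonant) :
    ∃ ε > 0, ∃ B > 0, ∀ z ∈ Metric.ball z₀ ε, ∀ n : ℕ,
      (n + 1 : ℝ) ≤ B * ‖(n : ℂ) + 1 + 2 * z‖ := by
  have hlim : Filter.Tendsto (fun n : ℕ => ‖(1 + 2 * z₀ * (1 / ((n : ℂ) + 1)))⁻¹‖)
      Filter.atTop (nhds ‖(1 + 2 * z₀ * 0 : ℂ)⁻¹‖) := by
    refine (Filter.Tendsto.inv₀ ?_ (by simp)).norm
    exact ((tendsto_one_div_add_atTop_nhds_zero_nat (𝕜 := ℂ)).const_mul _).const_add _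
  obtain ⟨B₀, hB₀⟩ := hlim.bddAbove_range
  set B := max B₀ 1
  have hB : 0 < B := lt_of_lt_of_le one_pos (le_max_right _ _)
  have key (n : ℕ) : (n + 1 : ℝ) ≤ B * ‖(n : ℂ) + 1 + 2 * z₀‖ := by
    have h1 : (n : ℂ) + 1 ≠ 0 := by exact_mod_cast n.succ_ne_zero
    have h2 : (1 + 2 * z₀ * (1 / ((n : ℂ) + 1)))⁻¹ = ((n : ℂ) + 1) / (n + 1 + 2 * z₀) := by
      rw [inv_eq_one_div]
      have := hz₀ n
      have h3 : 1 + 2 * z₀ * (1 / ((n : ℂ) + 1)) = (n + 1 + 2 * z₀) / (n + 1) := by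
        field_simp
      rw [h3, one_div_div]
    have h3 : ‖(1 + 2 * z₀ * (1 / ((n : ℂ) + 1)))⁻¹‖ ≤ B :=
      (hB₀ ⟨n, rfl⟩).trans (le_max_left _ _)
    rw [h2, norm_div, div_le_iff₀ (norm_pos_iff.2 (hz₀ n))] at h3
    have h4 : ‖(n : ℂ) + 1‖ = n + 1 := by
      exact_mod_cast Complex.norm_natCast (n + 1)
    rwa [h4] at h3
  refine ⟨1 / (4 * B), by positivity, 2 * B, by positivity, fun z hz n => ?_⟩
  have h1 : ‖(n : ℂ) + 1 + 2 * z₀‖ ≤ ‖(n : ℂ) + 1 + 2 * z‖ + 2 * ‖z - z₀‖ := by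
    calc ‖(n : ℂ) + 1 + 2 * z₀‖ = ‖((n : ℂ) + 1 + 2 * z) - 2 * (z - z₀)‖ := by ring_nf
      _ ≤ _ := (norm_sub_le _ _).trans (by simp)
  have h2 : ‖z - z₀‖ * (4 * B) < 1 := by
    rw [Metric.mem_ball, dist_eq_norm, lt_div_iff₀ (by positivity)] at hz
    exact hz
  have h3 := key n
  have h4 := mul_le_mul_of_nonneg_left h1 hB.le
  have h5 : (0 : ℝ) ≤ n := n.cast_nonneg
  nlinarith

lemma isOpen_nonresonant : IsOpen nonresonant := by
  refine Metric.isOpen_iff.2 fun z₀ hz₀ => ?_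
  obtain ⟨ε, hε, B, hB, h⟩ := exists_ball_linear_bound hz₀
  refine ⟨ε, hε, fun z hz n h0 => ?_⟩
  have := h z hz n
  rw [h0, norm_zero, mul_zero] at this
  linarith [n.cast_nonneg (α := ℝ)]

/-- A discrete Gronwall inequality giving polynomial growth. -/
lemma sum_range_le_pow_of_le {g : ℕ → ℝ} {K : ℕ} (h0 : g 0 = 1)
    (hg : ∀ n : ℕ, (n + 1) * g (n + 1) ≤ K * ∑ j ∈ Finset.range (n + 1), g j) (n : ℕ) :
    ∑ j ∈ Finset.range (n + 1), g j ≤ (n + 1 : ℝ) ^ K := by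
  induction n with
  | zero => simp [h0]
  | succ n ih =>
    rw [Finset.sum_range_succ]
    have hn : (0 : ℝ) < n + 1 := by positivity
    have hB : 1 + (K : ℝ) * (1 / (n + 1)) ≤ (1 + 1 / (n + 1)) ^ K :=
      one_add_mul_le_pow (by have : (0 : ℝ) ≤ 1 / (n + 1) := by positivity
                             linarith) K
    have h1 : g (n + 1) ≤ K * (1 / (n + 1)) * ∑ j ∈ Finset.range (n + 1), g j := by
      have := hg n
      rw [← le_div_iff₀' hn] at this
      exact this.trans_eq (by ring)
    calc _ ≤ (1 + (K : ℝ) * (1 / (n + 1))) * ∑ j ∈ Finset.range (n + 1), g j := by linarith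
      _ ≤ (1 + (K : ℝ) * (1 / (n + 1))) * (n + 1 : ℝ) ^ K := by gcongr
      _ ≤ (1 + 1 / (n + 1)) ^ K * (n + 1 : ℝ) ^ K := by gcongr
      _ = _ := by
        rw [← mul_pow]
        congr 1
        push_cast
        field_simp

lemma exists_ball_frobeniusCoeff_le {p s : ℕ → ℂ} {z₀ : ℂ} (hz₀ : z₀ ∈ nonresonant)
    {ρ : ℝ} (hρ : 0 < ρ) (hp : Summable fun n => ‖p n‖ * ρ ^ n)
    (hs : Summable fun n => ‖s n‖ * ρ ^ n) :
    ∃ ε > 0, ∃ K : ℕ, ∀ z ∈ Metric.ball z₀ ε, ∀ n : ℕ,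
      ‖frobeniusCoeff p s z n‖ * ρ ^ n ≤ (n + 1 : ℝ) ^ K := by
  obtain ⟨ε, hε, B, hB, hlow⟩ := exists_ball_linear_bound hz₀
  set C := (∑' n, ‖p n‖ * ρ ^ n) + ∑' n, ‖s n‖ * ρ ^ n
  have hp0 : 0 ≤ ∑' n, ‖p n‖ * ρ ^ n := tsum_nonneg fun n => by positivity
  have hs0 : 0 ≤ ∑' n, ‖s n‖ * ρ ^ n := tsum_nonneg fun n => by positivity
  have hC : 0 ≤ C := add_nonneg hp0 hs0
  have hpC (n : ℕ) : ‖p n‖ * ρ ^ n ≤ C :=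
    (hp.le_tsum n fun _ _ => by positivity).trans (le_add_of_nonneg_right hs0)
  have hsC (n : ℕ) : ‖s n‖ * ρ ^ n ≤ C :=
    (hs.le_tsum n fun _ _ => by positivity).trans (le_add_of_nonneg_left hp0)
  set Z := ‖z₀‖ + ε
  have hZ : 0 ≤ Z := by positivity
  obtain ⟨K, hK⟩ := exists_nat_ge (B * (C * (1 + Z + Z ^ 2)))
  refine ⟨ε, hε, K, fun z hz n => ?_⟩
  have hzZ : ‖z‖ ≤ Z := by
    rw [Metric.mem_ball, dist_eq_norm] at hz
    have := norm_le_norm_add_norm_sub' z z₀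
    linarith
  set g : ℕ → ℝ := fun n => ‖frobeniusCoeff p s z n‖ * ρ ^ n
  have hg0 (n : ℕ) : 0 ≤ g n := by positivity
  have hterm (n j : ℕ) (hj : j ∈ Finset.range (n + 1)) :
      ‖((j + z) * p (n + 1 - j) - z ^ 2 * s (n + 1 - j)) * frobeniusCoeff p s z j‖ * ρ ^ (n + 1)
        ≤ (n + 1) * (C * (1 + Z + Z ^ 2)) * g j := by
    have hj' := Finset.mem_range.1 hj
    have hsplit : ρ ^ (n + 1) = ρ ^ (n + 1 - j) * ρ ^ j := by
      rw [← pow_add]; congr 1; omega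
    have hjn : (j : ℝ) ≤ n := by exact_mod_cast Nat.lt_succ_iff.1 hj'
    have h1 : ‖(j + z) * p (n + 1 - j) - z ^ 2 * s (n + 1 - j)‖
        ≤ (n + Z) * ‖p (n + 1 - j)‖ + Z ^ 2 * ‖s (n + 1 - j)‖ := by
      refine (norm_sub_le _ _).trans ?_
      rw [norm_mul, norm_mul, norm_pow]
      have : ‖(j : ℂ) + z‖ ≤ n + Z := by
        refine (norm_add_le _ _).trans ?_
        rw [Complex.norm_natCast]; linarith
      gcongr
    rw [norm_mul, hsplit]
    calc _ = ‖(j + z) * p (n + 1 - j) - z ^ 2 * s (n + 1 - j)‖ * ρ ^ (n + 1 - j) * g j := by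
          simp only [g]; ring
      _ ≤ ((n + Z) * ‖p (n + 1 - j)‖ + Z ^ 2 * ‖s (n + 1 - j)‖) * ρ ^ (n + 1 - j) * g j := by
          have := hg0 j
          gcongr
      _ = ((n + Z) * (‖p (n + 1 - j)‖ * ρ ^ (n + 1 - j))
            + Z ^ 2 * (‖s (n + 1 - j)‖ * ρ ^ (n + 1 - j))) * g j := by ring
      _ ≤ ((n + Z) * C + Z ^ 2 * C) * g j := by
          have := hg0 j
          have := hpC (n + 1 - j)
          have := hsC (n + 1 - j)
          gcongr
      _ ≤ _ := by
          refine mul_le_mul_of_nonneg_right ?_ (hg0 j)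
          have hn : (0 : ℝ) ≤ n := n.cast_nonneg
          have : 0 ≤ C * (1 + n * Z + n * Z ^ 2) := by positivity
          nlinarith
  have hrec (n : ℕ) : (n + 1) * g (n + 1) ≤ K * ∑ j ∈ Finset.range (n + 1), g j := by
    have hn : (0 : ℝ) < n + 1 := by positivity
    have hD : 0 < ‖(n : ℂ) + 1 + 2 * z‖ := by
      have := hlow z hz n
      exact pos_of_mul_pos_right (hn.trans_le this) hB.le
    have hn' : ‖(n : ℂ) + 1‖ = n + 1 := by exact_mod_cast Complex.norm_natCast (n + 1)
    set T := ∑ j ∈ Finset.range (n + 1), g j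
    have hT : 0 ≤ T := Finset.sum_nonneg fun j _ => hg0 j
    have hnum : ‖∑ j ∈ Finset.range (n + 1),
        ((j + z) * p (n + 1 - j) - z ^ 2 * s (n + 1 - j)) * frobeniusCoeff p s z j‖ * ρ ^ (n + 1)
        ≤ (n + 1) * (C * (1 + Z + Z ^ 2)) * T := by
      rw [Finset.mul_sum]
      refine (mul_le_mul_of_nonneg_right (norm_sum_le _ _) (by positivity)).trans ?_
      rw [Finset.sum_mul]
      exact Finset.sum_le_sum (hterm n)
    have hg1 : (n + 1) * g (n + 1) * ‖(n : ℂ) + 1 + 2 * z‖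
        ≤ (n + 1) * (C * (1 + Z + Z ^ 2)) * T := by
      refine le_trans (le_of_eq ?_) hnum
      simp only [g]
      rw [frobeniusCoeff_succ, norm_div, norm_mul, norm_neg, hn']
      have hD' := hD.ne'
      generalize ‖(n : ℂ) + 1 + 2 * z‖ = D at hD' ⊢
      field_simp
    refine le_of_mul_le_mul_right (hg1.trans ?_) hD
    calc (n + 1) * (C * (1 + Z + Z ^ 2)) * T
        ≤ (B * ‖(n : ℂ) + 1 + 2 * z‖) * (C * (1 + Z + Z ^ 2)) * T := by
          have := hlow z hz n
          gcongr
      _ = (B * (C * (1 + Z + Z ^ 2))) * T * ‖(n : ℂ) + 1 + 2 * z‖ := by ring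
      _ ≤ _ := by gcongr
  calc g n ≤ ∑ j ∈ Finset.range (n + 1), g j :=
        Finset.single_le_sum (fun j _ => hg0 j) (Finset.self_mem_range_succ n)
    _ ≤ _ := sum_range_le_pow_of_le (by simp [g, frobeniusCoeff]) hrec n

/-- Termwise differentiation of a power series, in the form adapted to `θ = t d/dt`. -/
lemma powerSeries_differentiableAt_and_hasSum {c : ℕ → ℂ} {a : ℝ}
    (hc : ∀ ρ, 0 < ρ → ρ < a → Summable fun n => ‖c n‖ * ρ ^ n) {t : ℂ} (ht : ‖t‖ < a) :
    DifferentiableAt ℂ (fun w => ∑' n, c n * w ^ n) t ∧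
      HasSum (fun n : ℕ => (n * c n) * t ^ n) (t * deriv (fun w => ∑' n, c n * w ^ n) t) := by
  obtain ⟨ρ, htρ, hρa⟩ := exists_between ht
  have hρ : 0 < ρ := (norm_nonneg t).trans_lt htρ
  have hdiff (n : ℕ) : DifferentiableOn ℂ (fun w => c n * w ^ n) (Metric.ball 0 ρ) := by fun_prop
  have hbound (n : ℕ) (w : ℂ) (hw : w ∈ Metric.ball (0 : ℂ) ρ) :
      ‖c n * w ^ n‖ ≤ ‖c n‖ * ρ ^ n := by
    rw [norm_mul, norm_pow]
    have := (mem_ball_zero_iff.1 hw).le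
    gcongr
  have htmem : t ∈ Metric.ball (0 : ℂ) ρ := mem_ball_zero_iff.2 htρ
  refine ⟨(Complex.differentiableOn_tsum_of_summable_norm (hc ρ hρ hρa) hdiff Metric.isOpen_ball
    hbound).differentiableAt (Metric.isOpen_ball.mem_nhds htmem), ?_⟩
  have h := (Complex.hasSum_deriv_of_summable_norm (hc ρ hρ hρa) hdiff Metric.isOpen_ball
    hbound htmem).mul_left t
  refine h.congr_fun fun n => ?_
  rw [((hasDerivAt_pow n t).const_mul (c n)).deriv]
  cases n with
  | zero => simp
  | succ n => simp only [Nat.add_sub_cancel, pow_succ]; ring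

lemma summable_natCast_mul {c : ℕ → ℂ} {a : ℝ}
    (hc : ∀ ρ, 0 < ρ → ρ < a → Summable fun n => ‖c n‖ * ρ ^ n) {ρ : ℝ} (hρ : 0 < ρ)
    (hρa : ρ < a) : Summable fun n : ℕ => ‖n * c n‖ * ρ ^ n := by
  have h := (powerSeries_differentiableAt_and_hasSum hc (t := (ρ : ℂ))
    (by simpa [abs_of_pos hρ] using hρa)).2.summable.norm
  simpa [abs_of_pos hρ] using h

lemma exists_taylorCoeff {f : ℂ → ℂ} {a : ℝ}
    (hf : DifferentiableOn ℂ f (Metric.ball 0 a)) :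
    ∃ c : ℕ → ℂ, c 0 = f 0 ∧ (∀ t ∈ Metric.ball (0 : ℂ) a, HasSum (fun n => c n * t ^ n) (f t)) ∧
      ∀ ρ, 0 < ρ → ρ < a → Summable fun n => ‖c n‖ * ρ ^ n := by
  refine ⟨fun n => (n.factorial : ℂ)⁻¹ * iteratedDeriv n f 0, by simp, ?_⟩
  have key : ∀ t ∈ Metric.ball (0 : ℂ) a,
      HasSum (fun n => (n.factorial : ℂ)⁻¹ * iteratedDeriv n f 0 * t ^ n) (f t) := by
    intro t ht
    refine (Complex.hasSum_taylorSeries_on_ball hf ht).congr_fun fun n => ?_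
    simp only [smul_eq_mul, sub_zero]
    ring
  refine ⟨key, fun ρ hρ hρa => ?_⟩
  have h := (key ρ (by simpa [abs_of_pos hρ] using hρa)).summable.norm
  simpa [abs_of_pos hρ] using h

lemma summable_frobeniusCoeff {p s : ℕ → ℂ} {a : ℝ}
    (hp : ∀ ρ, 0 < ρ → ρ < a → Summable fun n => ‖p n‖ * ρ ^ n)
    (hs : ∀ ρ, 0 < ρ → ρ < a → Summable fun n => ‖s n‖ * ρ ^ n)
    {z₀ : ℂ} (hz₀ : z₀ ∈ nonresonant) {ρ : ℝ} (hρ : 0 < ρ) (hρa : ρ < a) :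
    ∃ ε > 0, ∃ u : ℕ → ℝ, Summable u ∧
      ∀ z ∈ Metric.ball z₀ ε, ∀ n, ‖frobeniusCoeff p s z n‖ * ρ ^ n ≤ u n := by
  obtain ⟨σ, hρσ, hσa⟩ := exists_between hρa
  have hσ : 0 < σ := hρ.trans hρσ
  obtain ⟨ε, hε, K, h⟩ := exists_ball_frobeniusCoeff_le hz₀ hσ (hp σ hσ hσa) (hs σ hσ hσa)
  have hq : ρ / σ < 1 := (div_lt_one hσ).2 hρσ
  have hq0 : 0 < ρ / σ := div_pos hρ hσ
  refine ⟨ε, hε, fun n => (n + 1 : ℝ) ^ K * (ρ / σ) ^ n, ?_, fun z hz n => ?_⟩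
  · have h1 := (summable_nat_add_iff 1).2 (summable_pow_mul_geometric_of_norm_lt_one K
      (r := ρ / σ) (by rwa [Real.norm_of_nonneg hq0.le]))
    refine (h1.mul_right (ρ / σ)⁻¹).congr fun n => ?_
    push_cast
    rw [pow_succ]
    field_simp
  · calc _ = ‖frobeniusCoeff p s z n‖ * σ ^ n * (ρ / σ) ^ n := by
          rw [div_pow]; field_simp
      _ ≤ _ := mul_le_mul_of_nonneg_right (h z hz n) (by positivity)

/-- The Frobenius method for `(θ + z)² h + P (θ + z) h - z² S h = 0`, `θ = t d/dt`, at `t = 0`,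
with holomorphic dependence on the exponent `z`. -/
theorem exists_frobenius_solution {a : ℝ} {P S : ℂ → ℂ}
    (hP : DifferentiableOn ℂ P (Metric.ball 0 a)) (hS : DifferentiableOn ℂ S (Metric.ball 0 a))
    (hP0 : P 0 = 0) (hS0 : S 0 = 1) :
    ∃ H : ℂ → ℂ → ℂ,
      (∀ z ∈ nonresonant, DifferentiableOn ℂ (H z) (Metric.ball 0 a) ∧ H z 0 = 1) ∧
      (∀ t ∈ Metric.ball (0 : ℂ) a, DifferentiableOn ℂ (fun z => H z t) nonresonant) ∧
      ∀ z ∈ nonresonant, ∀ t ∈ Metric.ball (0 : ℂ) a,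
        t * deriv (fun w => w * deriv (H z) w) t + 2 * z * (t * deriv (H z) t) + z ^ 2 * H z t
          + P t * (t * deriv (H z) t + z * H z t) - z ^ 2 * (S t * H z t) = 0 := by
  obtain ⟨p, hp0, hpsum, hp⟩ := exists_taylorCoeff hP
  obtain ⟨s, hs0, hssum, hs⟩ := exists_taylorCoeff hS
  rw [hP0] at hp0
  rw [hS0] at hs0
  set h := frobeniusCoeff p s
  have hh : ∀ z ∈ nonresonant, ∀ ρ, 0 < ρ → ρ < a → Summable fun n => ‖h z n‖ * ρ ^ n := by
    intro z hz ρ hρ hρa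
    obtain ⟨ε, hε, u, hu, hle⟩ := summable_frobeniusCoeff hp hs hz hρ hρa
    exact hu.of_nonneg_of_le (fun n => by positivity) (hle z (Metric.mem_ball_self hε))
  refine ⟨fun z t => ∑' n, h z n * t ^ n, fun z hz => ⟨fun t ht => ?_, ?_⟩, fun t ht z hz => ?_,
    fun z hz t ht => ?_⟩
  · exact (powerSeries_differentiableAt_and_hasSum (hh z hz)
      (mem_ball_zero_iff.1 ht)).1.differentiableWithinAt
  · change ∑' n, h z n * (0 : ℂ) ^ n = 1
    rw [tsum_eq_single 0 fun n hn => by simp [hn]]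
    simp [h, frobeniusCoeff]
  · obtain ⟨ρ, htρ, hρa⟩ := exists_between (mem_ball_zero_iff.1 ht)
    have hρ : 0 < ρ := (norm_nonneg t).trans_lt htρ
    obtain ⟨ε, hε, u, hu, hle⟩ := summable_frobeniusCoeff hp hs hz hρ hρa
    have hopen : IsOpen (Metric.ball z ε ∩ nonresonant) :=
      Metric.isOpen_ball.inter isOpen_nonresonant
    refine ((Complex.differentiableOn_tsum_of_summable_norm hu (fun n => ?_) hopen
      fun n w hw => ?_).differentiableAt
        (hopen.mem_nhds ⟨Metric.mem_ball_self hε, hz⟩)).differentiableWithinAt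
    · exact ((differentiableOn_frobeniusCoeff p s n).mono Set.inter_subset_right).mul_const _
    · refine le_trans ?_ (hle w hw.1 n)
      rw [norm_mul, norm_pow]
      gcongr
  · have htn := mem_ball_zero_iff.1 ht
    set F : ℂ → ℂ := fun t => ∑' n, h z n * t ^ n
    have hc := hh z hz
    have hc1 : ∀ ρ, 0 < ρ → ρ < a → Summable fun n : ℕ => ‖n * h z n‖ * ρ ^ n :=
      fun ρ hρ hρa => summable_natCast_mul hc hρ hρa
    have abs_summable {c : ℕ → ℂ} (hc : ∀ ρ, 0 < ρ → ρ < a → Summable fun n => ‖c n‖ * ρ ^ n) :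
        Summable fun n => ‖c n * t ^ n‖ := by
      obtain ⟨ρ, htρ, hρa⟩ := exists_between htn
      refine (hc ρ ((norm_nonneg t).trans_lt htρ) hρa).of_nonneg_of_le (fun _ => norm_nonneg _)
        fun n => ?_
      rw [norm_mul, norm_pow]
      gcongr
    have hF : HasSum (fun n => h z n * t ^ n) (F t) := (abs_summable hc).of_norm.hasSum
    have hF1 : HasSum (fun n : ℕ => (n * h z n) * t ^ n) (t * deriv F t) :=
      (powerSeries_differentiableAt_and_hasSum hc htn).2
    have hF2 : HasSum (fun n : ℕ => (n * (n * h z n)) * t ^ n)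
        (t * deriv (fun w => w * deriv F w) t) := by
      convert (powerSeries_differentiableAt_and_hasSum hc1 htn).2 using 2
      refine Filter.EventuallyEq.deriv_eq ?_
      filter_upwards [Metric.isOpen_ball.mem_nhds ht] with w hw
      exact (powerSeries_differentiableAt_and_hasSum hc (mem_ball_zero_iff.1 hw)).2.tsum_eq.symm
    have cauchy {f g : ℕ → ℂ} {x y : ℂ} (hf : Summable fun n => ‖f n * t ^ n‖)
        (hg : Summable fun n => ‖g n * t ^ n‖) (hx : HasSum (fun n => f n * t ^ n) x)
        (hy : HasSum (fun n => g n * t ^ n) y) :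
        HasSum (fun n => (∑ kl ∈ Finset.HasAntidiagonal.antidiagonal n, f kl.1 * g kl.2) * t ^ n)
          (x * y) := by
      rw [← hx.tsum_eq, ← hy.tsum_eq, tsum_mul_tsum_eq_tsum_sum_antidiagonal_of_summable_norm hf hg]
      refine (summable_norm_sum_mul_antidiagonal_of_summable_norm hf hg).of_norm.hasSum.congr_fun
        fun n => ?_
      rw [Finset.sum_mul]
      refine Finset.sum_congr rfl fun kl hkl => ?_
      rw [← Finset.HasAntidiagonal.mem_antidiagonal.1 hkl, pow_add]
      ring
    have hG : HasSum (fun n : ℕ => ((n + z) * h z n) * t ^ n) (t * deriv F t + z * F t) :=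
      (hF1.add (hF.mul_left z)).congr_fun fun n => by ring
    have hGs : Summable fun n : ℕ => ‖((n + z) * h z n) * t ^ n‖ := hG.summable.norm
    have hPG := cauchy hGs (abs_summable hp) hG (hpsum t ht)
    have hSF := cauchy (abs_summable hc) (abs_summable hs) hF (hssum t ht)
    have htot := (((hF2.add (hF1.mul_left (2 * z))).add (hF.mul_left (z ^ 2))).add hPG).sub
      (hSF.mul_left (z ^ 2))
    have hzero := htot.unique ((hasSum_zero (α := ℂ) (β := ℕ)).congr_fun fun n => by
      have := frobeniusCoeff_recurrence hp0 hs0 hz n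
      linear_combination t ^ n * this)
    linear_combination hzero

lemma hasDerivAt_comp_const_sub_ofReal {f : ℂ → ℂ} {f' : ℂ} {x r : ℝ}
    (hf : HasDerivAt f f' ((x - r : ℝ) : ℂ)) :
    HasDerivAt (fun s : ℝ => f ((x - s : ℝ) : ℂ)) (-f') r := by
  have h : HasDerivAt (fun s : ℝ => ((x - s : ℝ) : ℂ)) (-1 : ℂ) r := by
    simpa using ((hasDerivAt_id r).const_sub x).ofReal_comp
  simpa [Function.comp_def] using HasDerivAt.scomp r hf h

lemma hasDerivAt_cpow_mul {z w f' : ℂ} {f : ℂ → ℂ} (hw : w ∈ Complex.slitPlane)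
    (hf : HasDerivAt f f' w) :
    HasDerivAt (fun v => v ^ z * f v) (w⁻¹ * (w ^ z * (z * f w + w * f'))) w := by
  have h0 : w ≠ 0 := Complex.slitPlane_ne_zero hw
  have h := ((hasDerivAt_id w).cpow_const (c := z) hw).mul hf
  refine h.congr_deriv ?_
  simp only [id]
  rw [Complex.cpow_sub _ _ h0, Complex.cpow_one]
  field_simp

/-- The radial o.d.e. in Frobenius form near a simple zero `rc` of `μ`: here `t = rc - r` and
`r² μ(r) = t q(t)`. -/
lemma solvesODE_of_frobenius {M e Λ rp rc : ℝ} (hrp : 0 < rp) (hrc : rp < rc) {q H : ℂ → ℂ}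
    {z ω : ℂ}
    (hq : DifferentiableOn ℂ q (Metric.ball 0 (rc - rp)))
    (hq0 : ∀ t ∈ Metric.ball (0 : ℂ) (rc - rp), q t ≠ 0)
    (hmu : ∀ r ∈ Set.Ioo rp rc,
      (r : ℂ) ^ 2 * (mu M e Λ r : ℂ) = ((rc - r : ℝ) : ℂ) * q ((rc - r : ℝ) : ℂ))
    (hω : ω ^ 2 * rc ^ 4 = -(z ^ 2 * q 0 ^ 2))
    (hH : DifferentiableOn ℂ H (Metric.ball 0 (rc - rp)))
    (hode : ∀ t ∈ Metric.ball (0 : ℂ) (rc - rp),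
      t * deriv (fun w => w * deriv H w) t + 2 * z * (t * deriv H t) + z ^ 2 * H t
        + t * deriv q t / q t * (t * deriv H t + z * H t)
        - z ^ 2 * ((q 0 / q t) ^ 2 * ((rc - t) / rc) ^ 4 * H t) = 0) :
    SolvesODE M e Λ ω (Set.Ioo rp rc) (fun r => ((rc - r : ℝ) : ℂ) ^ z * H ((rc - r : ℝ) : ℂ)) := by
  set U := Metric.ball (0 : ℂ) (rc - rp)
  have hU : IsOpen U := Metric.isOpen_ball
  have hmem {r : ℝ} (hr : r ∈ Set.Ioo rp rc) :
      ((rc - r : ℝ) : ℂ) ∈ U ∧ ((rc - r : ℝ) : ℂ) ∈ Complex.slitPlane := by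
    refine ⟨?_, Complex.ofReal_mem_slitPlane.2 (sub_pos.2 hr.2)⟩
    rw [mem_ball_zero_iff, Complex.norm_real, Real.norm_of_nonneg (sub_nonneg.2 hr.2.le)]
    linarith [hr.1]
  have hH1 {w : ℂ} (hw : w ∈ U) : HasDerivAt H (deriv H w) w :=
    (hH.differentiableAt (hU.mem_nhds hw)).hasDerivAt
  have hG {w : ℂ} (hw : w ∈ U) :
      HasDerivAt (fun w => w * deriv H w) (deriv (fun w => w * deriv H w) w) w :=
    (differentiableAt_id.mul
      ((hH.deriv hU).differentiableAt (hU.mem_nhds hw))).hasDerivAt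
  set Y : ℂ → ℂ := fun w => w ^ z * (z * H w + w * deriv H w)
  have hY {w : ℂ} (hw : w ∈ U) (hw' : w ∈ Complex.slitPlane) :
      HasDerivAt Y (w⁻¹ * (w ^ z * (z * (z * H w + w * deriv H w)
        + w * (z * deriv H w + deriv (fun w => w * deriv H w) w)))) w :=
    hasDerivAt_cpow_mul hw' (((hH1 hw).const_mul z).add (hG hw))
  set R : ℝ → ℂ := fun r => ((rc - r : ℝ) : ℂ) ^ z * H ((rc - r : ℝ) : ℂ)
  have hR {r : ℝ} (hr : r ∈ Set.Ioo rp rc) :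
      HasDerivAt R (-(((rc - r : ℝ) : ℂ)⁻¹ * Y ((rc - r : ℝ) : ℂ))) r :=
    hasDerivAt_comp_const_sub_ofReal (hasDerivAt_cpow_mul (hmem hr).2 (hH1 (hmem hr).1))
  refine ⟨fun r hr => (hR hr).differentiableAt, fun r hr => ?_, fun r hr => ?_⟩
  · have h := (hasDerivAt_comp_const_sub_ofReal
      ((hasDerivAt_inv (Complex.slitPlane_ne_zero (hmem hr).2)).mul
        (hY (hmem hr).1 (hmem hr).2))).neg.differentiableAt
    refine h.congr_of_eventuallyEq ?_
    filter_upwards [isOpen_Ioo.mem_nhds hr] with s hs using (hR hs).deriv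
  · obtain ⟨ht, ht'⟩ := hmem hr
    have hprod : (fun s : ℝ => (s : ℂ) ^ 2 * (mu M e Λ s : ℂ) * deriv R s) =ᶠ[nhds r]
        fun s : ℝ => -(q ((rc - s : ℝ) : ℂ) * Y ((rc - s : ℝ) : ℂ)) := by
      filter_upwards [isOpen_Ioo.mem_nhds hr] with s hs
      have h0 := Complex.slitPlane_ne_zero (hmem hs).2
      rw [(hR hs).deriv, hmu s hs]
      field_simp
    have hD : HasDerivAt (fun s : ℝ => -(q ((rc - s : ℝ) : ℂ) * Y ((rc - s : ℝ) : ℂ))) _ r :=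
      (hasDerivAt_comp_const_sub_ofReal
      ((hq.differentiableAt (hU.mem_nhds ht)).hasDerivAt.mul (hY ht ht'))).neg
    rw [hprod.deriv_eq, hD.deriv]
    have hr0 : (r : ℂ) ≠ 0 := by exact_mod_cast (hrp.trans hr.1).ne'
    have hrc0 : (rc : ℂ) ≠ 0 := by exact_mod_cast (hrp.trans hrc).ne'
    have hmu' := hmu r hr
    have hode' := hode _ ht
    have hqt := hq0 _ ht
    have ht0 := Complex.slitPlane_ne_zero ht'
    have hrt : (r : ℂ) = rc - ((rc - r : ℝ) : ℂ) := by push_cast; ring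
    have hmu'' : (mu M e Λ r : ℂ)
        = ((rc - r : ℝ) : ℂ) * q ((rc - r : ℝ) : ℂ) / (r : ℂ) ^ 2 := by
      rw [eq_div_iff (pow_ne_zero 2 hr0), ← hmu']; ring
    rw [hmu'']
    simp only [R, Y]
    rw [← hrt] at hode'
    generalize ((rc - r : ℝ) : ℂ) = t at *
    generalize deriv (fun w => w * deriv H w) t = G at *
    field_simp at hode' ⊢
    refine mul_left_cancel₀ (pow_ne_zero 4 hrc0) ?_
    linear_combination t ^ z * hode' + t ^ z * H t * r ^ 4 * hω

lemma sq_mul_mu {M e Λ r : ℝ} (hr : r ≠ 0) :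
    r ^ 2 * mu M e Λ r = -(Λ / 3) * r ^ 4 + r ^ 2 - 2 * M * r + e ^ 2 := by
  unfold mu
  field_simp
  ring

/-- The factorisation of the quartic `r² μ(r)` through its three given roots, the fourth being
minus their sum. -/
lemma sq_mul_mu_eq_prod {M e Λ rm rp rc r : ℝ} (h₀ : 0 < rm) (h₁ : rm < rp) (h₂ : rp < rc)
    (hzm : mu M e Λ rm = 0) (hzp : mu M e Λ rp = 0) (hzc : mu M e Λ rc = 0) (hr : r ≠ 0) :
    r ^ 2 * mu M e Λ r
      = (rc - r) * (Λ / 3 * (r - rp) * (r - rm) * (r + rm + rp + rc)) := by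
  have em := sq_mul_mu (M := M) (e := e) (Λ := Λ) h₀.ne'
  have ep := sq_mul_mu (M := M) (e := e) (Λ := Λ) (h₀.trans h₁).ne'
  have ec := sq_mul_mu (M := M) (e := e) (Λ := Λ) (h₀.trans (h₁.trans h₂)).ne'
  rw [hzm, mul_zero] at em
  rw [hzp, mul_zero] at ep
  rw [hzc, mul_zero] at ec
  rw [sq_mul_mu hr]
  have h1 : -(Λ / 3) * (rm ^ 3 + rm ^ 2 * rp + rm * rp ^ 2 + rp ^ 3) + (rm + rp) - 2 * M = 0 := by
    refine mul_left_cancel₀ (sub_ne_zero.2 h₁.ne') ?_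
    linear_combination em - ep
  have h2 : -(Λ / 3) * (rm ^ 3 + rm ^ 2 * rc + rm * rc ^ 2 + rc ^ 3) + (rm + rc) - 2 * M = 0 := by
    refine mul_left_cancel₀ (sub_ne_zero.2 (h₁.trans h₂).ne') ?_
    linear_combination em - ec
  have h3 : -(Λ / 3) * (rm ^ 2 + rp ^ 2 + rc ^ 2 + rm * rp + rm * rc + rp * rc) + 1 = 0 := by
    refine mul_left_cancel₀ (sub_ne_zero.2 h₂.ne') ?_
    linear_combination h2 - h1
  linear_combination (r - rm) * (r - rp) * h3 + (r - rm) * h1 - em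

/-- The cofactor of `t = rc - r` in `r² μ(r)`, as a polynomial in `t`. -/
def cofactor (Λ rm rp rc : ℝ) (t : ℂ) : ℂ :=
  Λ / 3 * ((rc - rp : ℝ) - t) * ((rc - rm : ℝ) - t) * ((2 * rc + rm + rp : ℝ) - t)

lemma differentiable_cofactor (Λ rm rp rc : ℝ) : Differentiable ℂ (cofactor Λ rm rp rc) := by
  unfold cofactor
  fun_prop

lemma cofactor_ne_zero {Λ rm rp rc : ℝ} (hΛ : 0 < Λ) (h₀ : 0 < rm) (h₁ : rm < rp) (h₂ : rp < rc)
    {t : ℂ} (ht : t ∈ Metric.ball (0 : ℂ) (rc - rp)) : cofactor Λ rm rp rc t ≠ 0 := by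
  have key {x : ℝ} (hx : rc - rp ≤ x) : (x : ℂ) - t ≠ 0 := by
    intro h
    rw [mem_ball_zero_iff, ← sub_eq_zero.1 h, Complex.norm_real, Real.norm_eq_abs] at ht
    linarith [le_abs_self x]
  have hΛ' : (Λ : ℂ) ≠ 0 := by exact_mod_cast hΛ.ne'
  exact mul_ne_zero (mul_ne_zero (mul_ne_zero (by simpa using hΛ') (key le_rfl))
    (key (by linarith))) (key (by linarith))

lemma cofactor_zero_eq {M e Λ rm rp rc : ℝ} (h₀ : 0 < rm) (h₁ : rm < rp) (h₂ : rp < rc)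
    (hzm : mu M e Λ rm = 0) (hzp : mu M e Λ rp = 0) (hzc : mu M e Λ rc = 0) :
    cofactor Λ rm rp rc 0 = 2 * (kappaC M e Λ rc : ℂ) * rc ^ 2 := by
  have hrc : rc ≠ 0 := (h₀.trans (h₁.trans h₂)).ne'
  set Q : ℝ → ℝ := fun r => Λ / 3 * (r - rp) * (r - rm) * (r + rm + rp + rc) / r ^ 2
  have hmu : mu M e Λ =ᶠ[nhds rc] fun r => (rc - r) * Q r := by
    filter_upwards [isOpen_ne.mem_nhds hrc] with r hr
    have hr' : r ≠ 0 := hr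
    have := sq_mul_mu_eq_prod h₀ h₁ h₂ hzm hzp hzc hr'
    simp only [Q]
    rw [mul_div_assoc', eq_div_iff (pow_ne_zero 2 hr'), ← this]
    ring
  have hQ : DifferentiableAt ℝ Q rc := by
    refine DifferentiableAt.div (by fun_prop) (by fun_prop) (pow_ne_zero 2 hrc)
  have hd : HasDerivAt (fun r => (rc - r) * Q r) (-1 * Q rc + (rc - rc) * deriv Q rc) rc :=
    ((hasDerivAt_id rc).const_sub rc).mul hQ.hasDerivAt
  have hreal : 2 * kappaC M e Λ rc * rc ^ 2
      = Λ / 3 * (rc - rp) * (rc - rm) * (2 * rc + rm + rp) := by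
    rw [kappaC, hmu.deriv_eq, hd.deriv]
    simp only [Q]
    field_simp
    ring
  unfold cofactor
  have := congrArg (fun x : ℝ => (x : ℂ)) hreal
  push_cast at this ⊢
  linear_combination -this

/-- Existence of the basis solutions `R_in,c`, `R_out,c` near `r = r_c`:
there is `δ > 0` and `Ĥ_{in/out}(ω,·)` real-analytic on `(r₊, r_c + δ)`, equal to `1`
at `r_c`, holomorphic in `ω` on `𝒰`, such that
`R_{in/out}(ω,r) = (r_c − r)^(∓iω/(2κ_c))·Ĥ_{in/out}(ω,r)` solve the radial o.d.e.
with frequency `ω` on `(r₊, r_c)`. -/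
theorem basis_solutions_cosmological_horizon (M e Λ rm rp rc : ℝ)
    (hM : 0 < M) (he : 0 < e) (hΛ : 0 < Λ)
    (h₀ : 0 < rm) (h₁ : rm < rp) (h₂ : rp < rc)
    (hzm : mu M e Λ rm = 0) (hzp : mu M e Λ rp = 0) (hzc : mu M e Λ rc = 0) :
    ∃ δ : ℝ, 0 < δ ∧ ∃ Hin Hout : ℂ → ℝ → ℂ,
      (∀ ω ∈ calU (kappaP M e Λ rp) (kappaM M e Λ rm) (kappaC M e Λ rc),
        AnalyticOnNhd ℝ (Hin ω) (Set.Ioo rp (rc + δ)) ∧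
        AnalyticOnNhd ℝ (Hout ω) (Set.Ioo rp (rc + δ)) ∧
        Hin ω rc = 1 ∧ Hout ω rc = 1) ∧
      (∀ r ∈ Set.Ioo rp (rc + δ),
        DifferentiableOn ℂ (fun ω => Hin ω r)
          (calU (kappaP M e Λ rp) (kappaM M e Λ rm) (kappaC M e Λ rc)) ∧
        DifferentiableOn ℂ (fun ω => Hout ω r)
          (calU (kappaP M e Λ rp) (kappaM M e Λ rm) (kappaC M e Λ rc))) ∧
      (∀ ω ∈ calU (kappaP M e Λ rp) (kappaM M e Λ rm) (kappaC M e Λ rc),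
        SolvesODE M e Λ ω (Set.Ioo rp rc)
          (fun r => ((rc - r : ℝ) : ℂ) ^ (-(Complex.I * ω) / (2 * (kappaC M e Λ rc : ℂ))) * Hin ω r) ∧
        SolvesODE M e Λ ω (Set.Ioo rp rc)
          (fun r => ((rc - r : ℝ) : ℂ) ^ ((Complex.I * ω) / (2 * (kappaC M e Λ rc : ℂ))) * Hout ω r)) := by
  set κ : ℂ := (kappaC M e Λ rc : ℂ) with hκdef
  set q := cofactor Λ rm rp rc
  have hrc : 0 < rc := h₀.trans (h₁.trans h₂)
  have hrc' : (rc : ℂ) ≠ 0 := by exact_mod_cast hrc.ne'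
  have ha : 0 < rc - rp := sub_pos.2 h₂
  have hq0 : ∀ t ∈ Metric.ball (0 : ℂ) (rc - rp), q t ≠ 0 :=
    fun t ht => cofactor_ne_zero hΛ h₀ h₁ h₂ ht
  have hqκ : q 0 = 2 * κ * rc ^ 2 := cofactor_zero_eq h₀ h₁ h₂ hzm hzp hzc
  have hq00 : q 0 ≠ 0 := hq0 0 (Metric.mem_ball_self ha)
  have hκ : κ ≠ 0 := by
    intro h
    rw [hqκ, h] at hq00
    simp at hq00
  have hq : DifferentiableOn ℂ q (Metric.ball 0 (rc - rp)) :=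
    (differentiable_cofactor Λ rm rp rc).differentiableOn
  obtain ⟨H, hH, hHz, hode⟩ := exists_frobenius_solution (a := rc - rp)
    (P := fun t => t * deriv q t / q t) (S := fun t => (q 0 / q t) ^ 2 * ((rc - t) / rc) ^ 4)
    ((differentiableOn_id.mul (hq.deriv Metric.isOpen_ball)).div hq hq0)
    ((((differentiableOn_const _).div hq hq0).pow 2).mul (by fun_prop))
    (by simp) (by simp [hq00, hrc'])
  have hmu : ∀ r ∈ Set.Ioo rp rc,
      (r : ℂ) ^ 2 * (mu M e Λ r : ℂ) = ((rc - r : ℝ) : ℂ) * q ((rc - r : ℝ) : ℂ) := by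
    intro r hr
    have hr0 : r ≠ 0 := (h₀.trans (h₁.trans hr.1)).ne'
    have := congrArg (fun x : ℝ => (x : ℂ)) (sq_mul_mu_eq_prod h₀ h₁ h₂ hzm hzp hzc hr0)
    simp only [q, cofactor]
    push_cast at this ⊢
    rw [this]
    ring
  have hball {r : ℝ} (hr : r ∈ Set.Ioo rp (rc + (rc - rp))) :
      ((rc - r : ℝ) : ℂ) ∈ Metric.ball (0 : ℂ) (rc - rp) := by
    rw [mem_ball_zero_iff, Complex.norm_real, Real.norm_eq_abs, abs_lt]
    constructor <;> linarith [hr.1, hr.2]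
  have hanalytic {z : ℂ} (hz : z ∈ nonresonant) :
      AnalyticOnNhd ℝ (fun r : ℝ => H z ((rc - r : ℝ) : ℂ)) (Set.Ioo rp (rc + (rc - rp))) := by
    intro r hr
    have h1 : AnalyticAt ℝ (H z) ((rc - r : ℝ) : ℂ) :=
      ((hH z hz).1.analyticOnNhd Metric.isOpen_ball _ (hball hr)).restrictScalars
    have h2 : AnalyticAt ℝ (fun r : ℝ => ((rc - r : ℝ) : ℂ)) r :=
      (Complex.ofRealCLM.analyticAt _).comp (analyticAt_const.sub analyticAt_id)
    exact AnalyticAt.comp (f := fun r : ℝ => ((rc - r : ℝ) : ℂ)) h1 h2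
  have hsolves {z ω : ℂ} (hz : z ∈ nonresonant) (hω : ω ^ 2 = -(z ^ 2 * (2 * κ) ^ 2)) :
      SolvesODE M e Λ ω (Set.Ioo rp rc)
        (fun r => ((rc - r : ℝ) : ℂ) ^ z * H z ((rc - r : ℝ) : ℂ)) :=
    solvesODE_of_frobenius (h₀.trans h₁) h₂ hq hq0 hmu (by rw [hω, hqκ]; ring)
      (hH z hz).1 (hode z hz)
  have hres (σ : ℤ) (hσ : σ * σ = 1) {ω : ℂ}
      (hω : ω ∈ calU (kappaP M e Λ rp) (kappaM M e Λ rm) (kappaC M e Λ rc)) :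
      σ * (Complex.I * ω) / (2 * κ) ∈ nonresonant := by
    intro n h
    have hσ' : (σ : ℂ) * σ = 1 := by exact_mod_cast hσ
    have hσ0 : σ ≠ 0 := by rintro rfl; simp at hσ
    refine hω (kappaC M e Λ rc) (by simp) (σ * (n + 1)) (mul_ne_zero hσ0 (by omega)) ?_
    rw [← hκdef]
    push_cast
    field_simp at h
    linear_combination (-Complex.I * σ) * h + σ * σ * ω * Complex.I_mul_I - ω * hσ'
  have hin {ω : ℂ} (hω : ω ∈ calU (kappaP M e Λ rp) (kappaM M e Λ rm) (kappaC M e Λ rc)) :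
      -(Complex.I * ω) / (2 * κ) ∈ nonresonant := by
    simpa using hres (-1) (by norm_num) hω
  have hout {ω : ℂ} (hω : ω ∈ calU (kappaP M e Λ rp) (kappaM M e Λ rm) (kappaC M e Λ rc)) :
      Complex.I * ω / (2 * κ) ∈ nonresonant := by
    simpa using hres 1 (by norm_num) hω
  refine ⟨rc - rp, ha, fun ω r => H (-(Complex.I * ω) / (2 * κ)) ((rc - r : ℝ) : ℂ),
    fun ω r => H (Complex.I * ω / (2 * κ)) ((rc - r : ℝ) : ℂ), fun ω hω => ?_, fun r hr => ?_,
    fun ω hω => ?_⟩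
  · refine ⟨hanalytic (hin hω), hanalytic (hout hω), ?_, ?_⟩
    · simpa using (hH _ (hin hω)).2
    · simpa using (hH _ (hout hω)).2
  · exact ⟨(hHz _ (hball hr)).comp (g := fun z => H z ((rc - r : ℝ) : ℂ)) (by fun_prop) fun ω => hin,
      (hHz _ (hball hr)).comp (g := fun z => H z ((rc - r : ℝ) : ℂ)) (by fun_prop) fun ω => hout⟩
  · have hI : Complex.I ^ 2 = -1 := Complex.I_sq
    refine ⟨hsolves (hin hω) ?_, hsolves (hout hω) ?_⟩ <;>
    · field_simp
      simp [hI]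
end
end

section
/- Suppose given families of solutions of the radial o.d.e., all defined for ω in 𝒰 \ {0}: (a) R_in,+(ω,r) = |r − r₊|^(−iω/(2κ₊))·Ĥ_in,+(ω,r) and R_out,+(ω,r) = |r − r₊|^(iω/(2κ₊))·Ĥ_out,+(ω,r), solving the radial o.d.e. with frequency ω on (r₋, r₊) and on (r₊, r_c), where Ĥ_in,+, Ĥ_out,+ are real-analytic in r on (r₋, r_c) with value 1 at r₊; (b) R_in,c(ω,r) = (r_c − r)^(−iω/(2κ_c))·Ĥ_in,c(ω,r), solving the radial o.d.e. with frequency ω on (r₊, r_c), where Ĥ_in,c is C¹ in r up to r_c with Ĥ_in,c(ω, r_c) = 1; (c) R_in,−(ω,r) = (r − r₋)^(−iω/(2κ₋))·Ĥ_in,−(ω,r) and R_out,−(ω,r) = (r − r₋)^(iω/(2κ₋))·Ĥ_out,−(ω,r), solving the radial o.d.e. with frequency ω on (r₋, r₊), where Ĥ_in,−, Ĥ_out,− are C¹ in r up to r₋ with value 1 at r₋. Assume moreover that for each fixed r, the functions R_in,+, R_out,+, R_in,c, R_in,−, R_out,− and their r-derivatives are holomorphic in ω on 𝒰 \ {0}.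 Then there exist holomorphic functions 𝔄, 𝔅, 𝔄̃, 𝔅̃ : 𝒰 \ {0} → ℂ such that for all ω ∈ 𝒰 \ {0}: R_in,c(ω,r) = 𝔄(ω)·R_in,+(ω,r) + 𝔅(ω)·R_out,+(ω,r) for all r ∈ (r₊, r_c), and R_in,+(ω,r) = 𝔄̃(ω)·R_in,−(ω,r) + 𝔅̃(ω)·R_out,−(ω,r) for all r ∈ (r₋, r₊). -/
noncomputable section

/-- The set `𝒰 \ {0}`. -/
def calU' (kp km kc : ℝ) : Set ℂ := calU kp km kc \ {0}

/-- With three positive zeros, `r²·μ(r)` splits completely; its fourth zero is negative. -/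
theorem sq_mul_mu_eq {M e Λ a b c : ℝ} (ha : 0 < a) (hab : a < b) (hbc : b < c)
    (hza : mu M e Λ a = 0) (hzb : mu M e Λ b = 0) (hzc : mu M e Λ c = 0) {r : ℝ} (hr : r ≠ 0) :
    r ^ 2 * mu M e Λ r = -(Λ / 3) * ((r - a) * (r - b) * (r - c) * (r + a + b + c)) := by
  have key : ∀ s : ℝ, s ≠ 0 →
      s ^ 2 * mu M e Λ s = -(Λ / 3) * s ^ 4 + s ^ 2 - 2 * M * s + e ^ 2 := by
    intro s hs
    unfold mu
    field_simp
    ring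
  have qa := key a ha.ne'
  have qb := key b (ha.trans hab).ne'
  have qc := key c (ha.trans (hab.trans hbc)).ne'
  rw [hza, mul_zero] at qa
  rw [hzb, mul_zero] at qb
  rw [hzc, mul_zero] at qc
  have hab' : b - a ≠ 0 := (sub_pos.2 hab).ne'
  have hbc' : c - b ≠ 0 := (sub_pos.2 hbc).ne'
  have hac' : c - a ≠ 0 := (sub_pos.2 (hab.trans hbc)).ne'
  have d1 : -(Λ / 3) * (a ^ 3 + a ^ 2 * b + a * b ^ 2 + b ^ 3) + (a + b) - 2 * M = 0 := by
    apply mul_left_cancel₀ hab'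
    linear_combination qa - qb
  have d2 : -(Λ / 3) * (b ^ 3 + b ^ 2 * c + b * c ^ 2 + c ^ 3) + (b + c) - 2 * M = 0 := by
    apply mul_left_cancel₀ hbc'
    linear_combination qb - qc
  have d3 : -(Λ / 3) * (a ^ 2 + b ^ 2 + c ^ 2 + a * b + b * c + c * a) + 1 = 0 := by
    apply mul_left_cancel₀ hac'
    linear_combination d2 - d1
  rw [key r hr]
  linear_combination (r - a) * (r - b) * d3 + (r - a) * d1 - qa

theorem differentiableAt_mu (M e Λ : ℝ) {r : ℝ} (hr : r ≠ 0) :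
    DifferentiableAt ℝ (mu M e Λ) r := by
  unfold mu
  have : r ^ 2 ≠ 0 := pow_ne_zero 2 hr
  fun_prop (disch := assumption)

/-- A zero of `μ` with a simple linear factor in `r²·μ(r)` has nonzero derivative. -/
theorem deriv_mu_ne_zero {M e Λ r₀ : ℝ} {φ : ℝ → ℝ} (hr₀ : r₀ ≠ 0)
    (hφ : DifferentiableAt ℝ φ r₀) (hne : φ r₀ ≠ 0) (hz : mu M e Λ r₀ = 0)
    (h : ∀ r, r ≠ 0 → r ^ 2 * mu M e Λ r = (r - r₀) * φ r) :
    deriv (mu M e Λ) r₀ ≠ 0 := by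
  intro h0
  have h1 := ((hasDerivAt_id r₀).pow 2).mul (differentiableAt_mu M e Λ hr₀).hasDerivAt
  have h2 := ((hasDerivAt_id r₀).sub_const r₀).mul hφ.hasDerivAt
  have h3 := h1.unique (h2.congr_of_eventuallyEq
    ((eventually_ne_nhds hr₀).mono fun r hr => by simpa using h r hr))
  simp [hz, h0] at h3
  exact hne h3.symm

/-- The weighted Wronskian of two solutions of the radial o.d.e. is constant. -/
theorem SolvesODE.weighted_wronskian_eq {M e Λ a b : ℝ} {ω : ℂ} {f g : ℝ → ℂ} (ha : 0 < a)
    (hmu : ∀ r ∈ Set.Ioo a b, mu M e Λ r ≠ 0)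
    (hf : SolvesODE M e Λ ω (Set.Ioo a b) f) (hg : SolvesODE M e Λ ω (Set.Ioo a b) g)
    {r s : ℝ} (hr : r ∈ Set.Ioo a b) (hs : s ∈ Set.Ioo a b) :
    (r : ℂ) ^ 2 * mu M e Λ r * (f r * deriv g r - deriv f r * g r) =
      (s : ℂ) ^ 2 * mu M e Λ s * (f s * deriv g s - deriv f s * g s) := by
  have hflux : ∀ {u : ℝ → ℂ}, SolvesODE M e Λ ω (Set.Ioo a b) u → ∀ t ∈ Set.Ioo a b,
      DifferentiableAt ℝ (fun s : ℝ => (s : ℂ) ^ 2 * (mu M e Λ s : ℂ) * deriv u s) t := by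
    intro u hu t ht
    have h1 := hu.2.1 t ht
    have h2 : DifferentiableAt ℝ (fun s : ℝ => (mu M e Λ s : ℂ)) t :=
      (differentiableAt_mu M e Λ (ha.trans ht.1).ne').hasDerivAt.ofReal_comp.differentiableAt
    have h3 : DifferentiableAt ℝ (fun s : ℝ => (s : ℂ)) t :=
      Complex.ofRealCLM.differentiableAt
    exact ((h3.pow 2).mul h2).mul h1
  have hder : ∀ t ∈ Set.Ioo a b, HasDerivAt (fun s : ℝ =>
      f s * ((s : ℂ) ^ 2 * (mu M e Λ s : ℂ) * deriv g s) -
        g s * ((s : ℂ) ^ 2 * (mu M e Λ s : ℂ) * deriv f s)) 0 t := by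
    intro t ht
    have h := ((hf.1 t ht).hasDerivAt.mul (hflux hg t ht).hasDerivAt).sub
      ((hg.1 t ht).hasDerivAt.mul (hflux hf t ht).hasDerivAt)
    refine h.congr_deriv ?_
    have ef := hf.2.2 t ht
    have eg := hg.2.2 t ht
    have hc : ((t : ℂ) ^ 2)⁻¹ * (mu M e Λ t : ℂ) ≠ 0 :=
      mul_ne_zero (inv_ne_zero (pow_ne_zero 2 (Complex.ofReal_ne_zero.2 (ha.trans ht.1).ne')))
        (Complex.ofReal_ne_zero.2 (hmu t ht))
    apply mul_left_cancel₀ hc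
    linear_combination f t * eg - g t * ef
  have := isOpen_Ioo.is_const_of_deriv_eq_zero isPreconnected_Ioo
    (fun t ht => (hder t ht).differentiableAt.differentiableWithinAt)
    (fun t ht => (hder t ht).deriv) hr hs
  linear_combination this

/-- A solution is a combination of two others, with Wronskian quotients as coefficients. -/
theorem SolvesODE.eq_combination {M e Λ a b : ℝ} {ω : ℂ} {f g h : ℝ → ℂ} (ha : 0 < a)
    (hmu : ∀ r ∈ Set.Ioo a b, mu M e Λ r ≠ 0)
    (hf : SolvesODE M e Λ ω (Set.Ioo a b) f) (hg : SolvesODE M e Λ ω (Set.Ioo a b) g)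
    (hh : SolvesODE M e Λ ω (Set.Ioo a b) h) {s r : ℝ} (hs : s ∈ Set.Ioo a b)
    (hr : r ∈ Set.Ioo a b) (hW : f s * deriv g s - deriv f s * g s ≠ 0) :
    h r = (h s * deriv g s - deriv h s * g s) / (f s * deriv g s - deriv f s * g s) * f r +
      (f s * deriv h s - deriv f s * h s) / (f s * deriv g s - deriv f s * g s) * g r := by
  have e1 := hf.weighted_wronskian_eq ha hmu hg hr hs
  have e2 := hh.weighted_wronskian_eq ha hmu hg hr hs
  have e3 := hf.weighted_wronskian_eq ha hmu hh hr hs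
  have hc : (s : ℂ) ^ 2 * (mu M e Λ s : ℂ) ≠ 0 :=
    mul_ne_zero (pow_ne_zero 2 (Complex.ofReal_ne_zero.2 (ha.trans hs.1).ne'))
      (Complex.ofReal_ne_zero.2 (hmu s hs))
  rw [div_mul_eq_mul_div, div_mul_eq_mul_div, ← add_div, eq_div_iff hW]
  apply mul_left_cancel₀ hc
  linear_combination (-h r) * e1 + f r * e2 + g r * e3

theorem hasDerivAt_sub_cpow_mul {a r : ℝ} (c : ℂ) {H : ℝ → ℂ} {H' : ℂ} (har : a < r)
    (hH : HasDerivAt H H' r) :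
    HasDerivAt (fun s : ℝ => ((s - a : ℝ) : ℂ) ^ c * H s)
      (((r - a : ℝ) : ℂ) ^ c * (c / ((r - a : ℝ) : ℂ) * H r + H')) r := by
  have hx : ((r - a : ℝ) : ℂ) ≠ 0 := Complex.ofReal_ne_zero.2 (sub_pos.2 har).ne'
  have h1 : HasDerivAt (fun s : ℝ => ((s - a : ℝ) : ℂ)) 1 r := by
    simpa using ((hasDerivAt_id r).sub_const a).ofReal_comp
  have hs : ((r - a : ℝ) : ℂ) ∈ Complex.slitPlane :=
    Complex.ofReal_mem_slitPlane.2 (sub_pos.2 har)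
  have h0 : HasDerivAt (fun z : ℂ => z ^ c) (c * ((r - a : ℝ) : ℂ) ^ (c - 1)) ((r - a : ℝ) : ℂ) :=
    ((hasDerivAt_id _).cpow_const hs).congr_deriv (mul_one _)
  have h2 : HasDerivAt (fun s : ℝ => ((s - a : ℝ) : ℂ) ^ c)
      (c * ((r - a : ℝ) : ℂ) ^ (c - 1) * 1) r :=
    HasDerivAt.comp (h₂ := fun z : ℂ => z ^ c) r h0 h1
  refine (h2.mul hH).congr_deriv ?_
  rw [Complex.cpow_sub _ _ hx, Complex.cpow_one]
  field_simp

/-- Frobenius-type functions with opposite nonzero exponents are linearly independent. -/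
theorem exists_wronskian_ne_zero {a b : ℝ} (hab : a < b) {α : ℂ} (hα : α ≠ 0)
    {f g H K : ℝ → ℂ}
    (hf : ∀ r ∈ Set.Ioo a b, f r = ((r - a : ℝ) : ℂ) ^ (-α) * H r)
    (hg : ∀ r ∈ Set.Ioo a b, g r = ((r - a : ℝ) : ℂ) ^ α * K r)
    (hH : ContDiffOn ℝ 1 H (Set.Ico a b)) (hK : ContDiffOn ℝ 1 K (Set.Ico a b))
    (hHa : H a = 1) (hKa : K a = 1) :
    ∃ r ∈ Set.Ioo a b, f r * deriv g r - deriv f r * g r ≠ 0 := by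
  by_contra! hW
  have hmem : a ∈ Set.Ico a b := ⟨le_rfl, hab⟩
  have hu : UniqueDiffOn ℝ (Set.Ico a b) := uniqueDiffOn_Ico a b
  set H' := derivWithin H (Set.Ico a b)
  set K' := derivWithin K (Set.Ico a b)
  let F : ℝ → ℂ := fun r => 2 * α * (H r * K r) + ((r - a : ℝ) : ℂ) * (H r * K' r - H' r * K r)
  have hF : ContinuousOn F (Set.Ico a b) := by
    have c1 := hH.continuousOn
    have c2 := hK.continuousOn
    have c3 : ContinuousOn H' (Set.Ico a b) := hH.continuousOn_derivWithin hu le_rfl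
    have c4 : ContinuousOn K' (Set.Ico a b) := hK.continuousOn_derivWithin hu le_rfl
    have c5 : ContinuousOn (fun r : ℝ => ((r - a : ℝ) : ℂ)) (Set.Ico a b) := by fun_prop
    exact (continuousOn_const.mul (c1.mul c2)).add (c5.mul ((c1.mul c4).sub (c3.mul c2)))
  have hzero : ∀ r ∈ Set.Ioo a b, F r = 0 := by
    intro r hr
    have hn : Set.Ico a b ∈ nhds r := Ico_mem_nhds hr.1 hr.2
    have hrm : r ∈ Set.Ico a b := ⟨hr.1.le, hr.2⟩
    have dH : HasDerivAt H (H' r) r :=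
      ((hH.differentiableOn one_ne_zero) r hrm).hasDerivWithinAt.hasDerivAt hn
    have dK : HasDerivAt K (K' r) r :=
      ((hK.differentiableOn one_ne_zero) r hrm).hasDerivWithinAt.hasDerivAt hn
    have hev : Set.Ioo a b ∈ nhds r := isOpen_Ioo.mem_nhds hr
    have df := ((hasDerivAt_sub_cpow_mul (-α) hr.1 dH).congr_of_eventuallyEq
      (Filter.eventually_of_mem hev hf)).deriv
    have dg := ((hasDerivAt_sub_cpow_mul α hr.1 dK).congr_of_eventuallyEq
      (Filter.eventually_of_mem hev hg)).deriv
    have hx : ((r - a : ℝ) : ℂ) ≠ 0 := Complex.ofReal_ne_zero.2 (sub_pos.2 hr.1).ne'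
    have hp : ((r - a : ℝ) : ℂ) ^ α ≠ 0 := fun h =>
      hx ((Complex.cpow_eq_zero_iff _ _).1 h).1
    have h0 := hW r hr
    rw [df, dg, hf r hr, hg r hr, Complex.cpow_neg] at h0
    simp only [F]
    generalize ((r - a : ℝ) : ℂ) ^ α = p at hp h0
    generalize ((r - a : ℝ) : ℂ) = x at hx h0 ⊢
    field_simp at h0
    linear_combination h0
  have hlim : Filter.Tendsto F (nhdsWithin a (Set.Ioo a b)) (nhds (F a)) :=
    (hF a hmem).mono_left (nhdsWithin_mono a Set.Ioo_subset_Ico_self)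
  have : (nhdsWithin a (Set.Ioo a b)).NeBot := left_nhdsWithin_Ioo_neBot hab
  have hFa : F a = 0 := tendsto_nhds_unique hlim
    (tendsto_const_nhds.congr' (Filter.eventually_of_mem self_mem_nhdsWithin
      fun r hr => (hzero r hr).symm))
  simp [F, hHa, hKa, hα] at hFa

/-- The Wronskian of two solutions of Frobenius type vanishes nowhere. -/
theorem SolvesODE.wronskian_ne_zero {M e Λ a b : ℝ} {ω α : ℂ} {f g H K : ℝ → ℂ} (ha : 0 < a)
    (hmu : ∀ r ∈ Set.Ioo a b, mu M e Λ r ≠ 0)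
    (hf : SolvesODE M e Λ ω (Set.Ioo a b) f) (hg : SolvesODE M e Λ ω (Set.Ioo a b) g)
    (hα : α ≠ 0)
    (hfH : ∀ r ∈ Set.Ioo a b, f r = ((r - a : ℝ) : ℂ) ^ (-α) * H r)
    (hgK : ∀ r ∈ Set.Ioo a b, g r = ((r - a : ℝ) : ℂ) ^ α * K r)
    (hH : ContDiffOn ℝ 1 H (Set.Ico a b)) (hK : ContDiffOn ℝ 1 K (Set.Ico a b))
    (hHa : H a = 1) (hKa : K a = 1) {s : ℝ} (hs : s ∈ Set.Ioo a b) :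
    f s * deriv g s - deriv f s * g s ≠ 0 := by
  obtain ⟨r, hr, hW⟩ :=
    exists_wronskian_ne_zero (hs.1.trans hs.2) hα hfH hgK hH hK hHa hKa
  have hc : (r : ℂ) ^ 2 * (mu M e Λ r : ℂ) ≠ 0 :=
    mul_ne_zero (pow_ne_zero 2 (Complex.ofReal_ne_zero.2 (ha.trans hr.1).ne'))
      (Complex.ofReal_ne_zero.2 (hmu r hr))
  have h := mul_ne_zero hc hW
  rw [hf.weighted_wronskian_eq ha hmu hg hr hs] at h
  exact right_ne_zero_of_mul h

/-- Existence of the holomorphic connection coefficients `𝔄, 𝔅, 𝔄̃, 𝔅̃` expressing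
`R_in,c = 𝔄·R_in,+ + 𝔅·R_out,+` on `(r₊, r_c)` and
`R_in,+ = 𝔄̃·R_in,− + 𝔅̃·R_out,−` on `(r₋, r₊)`. -/
theorem connection_coefficients (M e Λ rm rp rc : ℝ)
    (hM : 0 < M) (he : 0 < e) (hΛ : 0 < Λ)
    (h₀ : 0 < rm) (h₁ : rm < rp) (h₂ : rp < rc)
    (hzm : mu M e Λ rm = 0) (hzp : mu M e Λ rp = 0) (hzc : mu M e Λ rc = 0)
    -- the hat functions
    (Hinp Houtp Hinc Hinm Houtm : ℂ → ℝ → ℂ)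
    -- the basis solutions, given in terms of the hat functions
    (Rinp Routp Rinc Rinm Routm : ℂ → ℝ → ℂ)
    (hRinp : ∀ ω r, Rinp ω r =
      ((|r - rp| : ℝ) : ℂ) ^ (-(Complex.I * ω) / (2 * (kappaP M e Λ rp : ℂ))) * Hinp ω r)
    (hRoutp : ∀ ω r, Routp ω r =
      ((|r - rp| : ℝ) : ℂ) ^ ((Complex.I * ω) / (2 * (kappaP M e Λ rp : ℂ))) * Houtp ω r)
    (hRinc : ∀ ω r, Rinc ω r =
      ((rc - r : ℝ) : ℂ) ^ (-(Complex.I * ω) / (2 * (kappaC M e Λ rc : ℂ))) * Hinc ω r)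
    (hRinm : ∀ ω r, Rinm ω r =
      ((r - rm : ℝ) : ℂ) ^ (-(Complex.I * ω) / (2 * (kappaM M e Λ rm : ℂ))) * Hinm ω r)
    (hRoutm : ∀ ω r, Routm ω r =
      ((r - rm : ℝ) : ℂ) ^ ((Complex.I * ω) / (2 * (kappaM M e Λ rm : ℂ))) * Houtm ω r)
    -- (a) regularity of the hats at r₊ and the o.d.e. for the + family
    (hHp : ∀ ω ∈ calU' (kappaP M e Λ rp) (kappaM M e Λ rm) (kappaC M e Λ rc),
      AnalyticOnNhd ℝ (Hinp ω) (Set.Ioo rm rc) ∧ AnalyticOnNhd ℝ (Houtp ω) (Set.Ioo rm rc) ∧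
      Hinp ω rp = 1 ∧ Houtp ω rp = 1)
    (hSp : ∀ ω ∈ calU' (kappaP M e Λ rp) (kappaM M e Λ rm) (kappaC M e Λ rc),
      SolvesODE M e Λ ω (Set.Ioo rm rp) (Rinp ω) ∧ SolvesODE M e Λ ω (Set.Ioo rp rc) (Rinp ω) ∧
      SolvesODE M e Λ ω (Set.Ioo rm rp) (Routp ω) ∧ SolvesODE M e Λ ω (Set.Ioo rp rc) (Routp ω))
    -- (b) regularity of the hat at r_c and the o.d.e. for R_in,c
    (hHc : ∀ ω ∈ calU' (kappaP M e Λ rp) (kappaM M e Λ rm) (kappaC M e Λ rc),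
      ContDiffOn ℝ 1 (Hinc ω) (Set.Ioc rp rc) ∧ Hinc ω rc = 1)
    (hSc : ∀ ω ∈ calU' (kappaP M e Λ rp) (kappaM M e Λ rm) (kappaC M e Λ rc),
      SolvesODE M e Λ ω (Set.Ioo rp rc) (Rinc ω))
    -- (c) regularity of the hats at r₋ and the o.d.e. for the − family
    (hHm : ∀ ω ∈ calU' (kappaP M e Λ rp) (kappaM M e Λ rm) (kappaC M e Λ rc),
      ContDiffOn ℝ 1 (Hinm ω) (Set.Ico rm rp) ∧ ContDiffOn ℝ 1 (Houtm ω) (Set.Ico rm rp) ∧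
      Hinm ω rm = 1 ∧ Houtm ω rm = 1)
    (hSm : ∀ ω ∈ calU' (kappaP M e Λ rp) (kappaM M e Λ rm) (kappaC M e Λ rc),
      SolvesODE M e Λ ω (Set.Ioo rm rp) (Rinm ω) ∧ SolvesODE M e Λ ω (Set.Ioo rm rp) (Routm ω))
    -- holomorphy in ω of the solutions and their r-derivatives, for fixed r
    (holp : ∀ r ∈ Set.Ioo rm rc, r ≠ rp →
      DifferentiableOn ℂ (fun ω => Rinp ω r) (calU' (kappaP M e Λ rp) (kappaM M e Λ rm) (kappaC M e Λ rc)) ∧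
      DifferentiableOn ℂ (fun ω => deriv (Rinp ω) r) (calU' (kappaP M e Λ rp) (kappaM M e Λ rm) (kappaC M e Λ rc)) ∧
      DifferentiableOn ℂ (fun ω => Routp ω r) (calU' (kappaP M e Λ rp) (kappaM M e Λ rm) (kappaC M e Λ rc)) ∧
      DifferentiableOn ℂ (fun ω => deriv (Routp ω) r) (calU' (kappaP M e Λ rp) (kappaM M e Λ rm) (kappaC M e Λ rc)))
    (holc : ∀ r ∈ Set.Ioo rp rc,
      DifferentiableOn ℂ (fun ω => Rinc ω r) (calU' (kappaP M e Λ rp) (kappaM M e Λ rm) (kappaC M e Λ rc)) ∧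
      DifferentiableOn ℂ (fun ω => deriv (Rinc ω) r) (calU' (kappaP M e Λ rp) (kappaM M e Λ rm) (kappaC M e Λ rc)))
    (holm : ∀ r ∈ Set.Ioo rm rp,
      DifferentiableOn ℂ (fun ω => Rinm ω r) (calU' (kappaP M e Λ rp) (kappaM M e Λ rm) (kappaC M e Λ rc)) ∧
      DifferentiableOn ℂ (fun ω => deriv (Rinm ω) r) (calU' (kappaP M e Λ rp) (kappaM M e Λ rm) (kappaC M e Λ rc)) ∧
      DifferentiableOn ℂ (fun ω => Routm ω r) (calU' (kappaP M e Λ rp) (kappaM M e Λ rm) (kappaC M e Λ rc)) ∧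
      DifferentiableOn ℂ (fun ω => deriv (Routm ω) r) (calU' (kappaP M e Λ rp) (kappaM M e Λ rm) (kappaC M e Λ rc))) :
    ∃ A B At Bt : ℂ → ℂ,
      DifferentiableOn ℂ A (calU' (kappaP M e Λ rp) (kappaM M e Λ rm) (kappaC M e Λ rc)) ∧
      DifferentiableOn ℂ B (calU' (kappaP M e Λ rp) (kappaM M e Λ rm) (kappaC M e Λ rc)) ∧
      DifferentiableOn ℂ At (calU' (kappaP M e Λ rp) (kappaM M e Λ rm) (kappaC M e Λ rc)) ∧
      DifferentiableOn ℂ Bt (calU' (kappaP M e Λ rp) (kappaM M e Λ rm) (kappaC M e Λ rc)) ∧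
      ∀ ω ∈ calU' (kappaP M e Λ rp) (kappaM M e Λ rm) (kappaC M e Λ rc),
        (∀ r ∈ Set.Ioo rp rc, Rinc ω r = A ω * Rinp ω r + B ω * Routp ω r) ∧
        (∀ r ∈ Set.Ioo rm rp, Rinp ω r = At ω * Rinm ω r + Bt ω * Routm ω r) := by
  have hrp := h₀.trans h₁
  have hfac : ∀ r : ℝ, r ≠ 0 → r ^ 2 * mu M e Λ r =
      -(Λ / 3) * ((r - rm) * (r - rp) * (r - rc) * (r + rm + rp + rc)) :=
    fun r hr => sq_mul_mu_eq h₀ h₁ h₂ hzm hzp hzc hr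
  have hmu : ∀ r, 0 < r → r ≠ rm → r ≠ rp → r ≠ rc → mu M e Λ r ≠ 0 := by
    intro r hr hm hp hc h0
    have h := hfac r hr.ne'
    rw [h0, mul_zero] at h
    have h4 : r + rm + rp + rc ≠ 0 := by linarith
    exact mul_ne_zero (neg_ne_zero.2 (by positivity)) (mul_ne_zero (mul_ne_zero (mul_ne_zero
      (sub_ne_zero.2 hm) (sub_ne_zero.2 hp)) (sub_ne_zero.2 hc)) h4) h.symm
  have hmu₁ : ∀ r ∈ Set.Ioo rm rp, mu M e Λ r ≠ 0 := fun r hr =>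
    hmu r (h₀.trans hr.1) hr.1.ne' hr.2.ne (hr.2.trans h₂).ne
  have hmu₂ : ∀ r ∈ Set.Ioo rp rc, mu M e Λ r ≠ 0 := fun r hr =>
    hmu r (hrp.trans hr.1) (h₁.trans hr.1).ne' hr.1.ne' hr.2.ne
  have hκp : kappaP M e Λ rp ≠ 0 := by
    refine mul_ne_zero (by norm_num) (deriv_mu_ne_zero
      (φ := fun r => -(Λ / 3) * ((r - rm) * (r - rc) * (r + rm + rp + rc)))
      hrp.ne' (by fun_prop) ?_ hzp fun r hr => by rw [hfac r hr]; ring)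
    have h4 : rp + rm + rp + rc ≠ 0 := by linarith
    exact mul_ne_zero (neg_ne_zero.2 (by positivity)) (mul_ne_zero (mul_ne_zero
      (sub_ne_zero.2 h₁.ne') (sub_ne_zero.2 h₂.ne)) h4)
  have hκm : kappaM M e Λ rm ≠ 0 := by
    refine mul_ne_zero (by norm_num) (deriv_mu_ne_zero
      (φ := fun r => -(Λ / 3) * ((r - rp) * (r - rc) * (r + rm + rp + rc)))
      h₀.ne' (by fun_prop) ?_ hzm fun r hr => by rw [hfac r hr]; ring)
    have h4 : rm + rm + rp + rc ≠ 0 := by linarith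
    exact mul_ne_zero (neg_ne_zero.2 (by positivity)) (mul_ne_zero (mul_ne_zero
      (sub_ne_zero.2 h₁.ne) (sub_ne_zero.2 (h₁.trans h₂).ne)) h4)
  have hexp : ∀ {κ : ℝ} {ω : ℂ}, κ ≠ 0 → ω ≠ 0 → Complex.I * ω / (2 * (κ : ℂ)) ≠ 0 :=
    fun hκ hω => div_ne_zero (mul_ne_zero Complex.I_ne_zero hω)
      (mul_ne_zero two_ne_zero (Complex.ofReal_ne_zero.2 hκ))
  obtain ⟨s, hs⟩ := exists_between h₂
  obtain ⟨t, ht⟩ := exists_between h₁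
  set U := calU' (kappaP M e Λ rp) (kappaM M e Λ rm) (kappaC M e Λ rc)
  have hWp : ∀ ω ∈ U, Rinp ω s * deriv (Routp ω) s - deriv (Rinp ω) s * Routp ω s ≠ 0 := by
    intro ω hω
    obtain ⟨hH, hK, hH1, hK1⟩ := hHp ω hω
    have hsub : Set.Ico rp rc ⊆ Set.Ioo rm rc := fun r hr => ⟨h₁.trans_le hr.1, hr.2⟩
    have habs : ∀ r ∈ Set.Ioo rp rc, |r - rp| = r - rp := fun r hr =>
      abs_of_pos (sub_pos.2 hr.1)
    exact (hSp ω hω).2.1.wronskian_ne_zero hrp hmu₂ (hSp ω hω).2.2.2 (hexp hκp hω.2)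
      (fun r hr => by rw [hRinp, habs r hr, neg_div]) (fun r hr => by rw [hRoutp, habs r hr])
      ((hH.contDiffOn isOpen_Ioo.uniqueDiffOn).mono hsub) ((hK.contDiffOn isOpen_Ioo.uniqueDiffOn).mono hsub) hH1 hK1 hs
  have hWm : ∀ ω ∈ U, Rinm ω t * deriv (Routm ω) t - deriv (Rinm ω) t * Routm ω t ≠ 0 := by
    intro ω hω
    obtain ⟨hH, hK, hH1, hK1⟩ := hHm ω hω
    exact (hSm ω hω).1.wronskian_ne_zero h₀ hmu₁ (hSm ω hω).2 (hexp hκm hω.2)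
      (fun r _ => by rw [hRinm, neg_div]) (fun r _ => hRoutm ω r) hH hK hH1 hK1 ht
  obtain ⟨p1, p2, p3, p4⟩ := holp s ⟨h₁.trans hs.1, hs.2⟩ hs.1.ne'
  obtain ⟨c1, c2⟩ := holc s hs
  obtain ⟨q1, q2, -, -⟩ := holp t ⟨ht.1, ht.2.trans h₂⟩ ht.2.ne
  obtain ⟨m1, m2, m3, m4⟩ := holm t ht
  have dp := (p1.mul p4).sub (p2.mul p3)
  have dm := (m1.mul m4).sub (m2.mul m3)
  exact ⟨_, _, _, _, ((c1.mul p4).sub (c2.mul p3)).div dp hWp,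
    ((p1.mul c2).sub (p2.mul c1)).div dp hWp,
    ((q1.mul m4).sub (q2.mul m3)).div dm hWm,
    ((m1.mul q2).sub (m2.mul q1)).div dm hWm, fun ω hω =>
    ⟨fun r hr => (hSp ω hω).2.1.eq_combination hrp hmu₂ (hSp ω hω).2.2.2 (hSc ω hω) hs hr
      (hWp ω hω),
     fun r hr => (hSm ω hω).1.eq_combination h₀ hmu₁ (hSm ω hω).2 (hSp ω hω).1 ht hr
      (hWm ω hω)⟩⟩
end
end
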